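/- Let E be a holomorphic vector bundle of finite rank over a bounded domain D ⊆ ℂⁿ equipped with a singular Finsler metric h such that the norm |u|_{h*} of every local holomorphic section u of the dual bundle E* is upper semicontinuous. If (E,h) has the multiple L^p-extension property for some p > 0, then (E,h) is positively curved in the sense of Griffiths: log|u|_{h*} is plurisubharmonic for every local holomorphic section u of E*. -/

import Mathlib

open MeasureTheory Complex Set
open scoped ENNReal NNReal

noncomputable section
attribute [local instance] Classical.propDecidable

/-- `e^x` as a map `EReal → ℝ≥0∞` (`e^{-∞} = 0`, `e^{+∞} = ∞`). -/
def expE (x : EReal) : ℝ≥0∞ := EReal.exp x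

/-- `log` as a map `ℝ≥0∞ → EReal`. -/
def logE (x : ℝ≥0∞) : EReal := ENNReal.log x

/-- Truncation of an extended real to `ℝ≥0∞`. -/
def toENN (x : EReal) : ℝ≥0∞ := if x = ⊤ then ⊤ else ENNReal.ofReal x.toReal

/-- The point `c + r·e^{iθ}` on the circle of center `c` and radius `r`. -/
def cpt (c : ℂ) (r θ : ℝ) : ℂ := c + r * Complex.exp (θ * Complex.I)

/-- The averaged "deficit" `M - (circle mean of u)` over the circle of center `c`, radius `r`,
for an upper bound `M` of `u` on that circle. -/
def circleDeficit (u : ℂ → EReal) (c : ℂ) (r M : ℝ) : ℝ≥0∞ :=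
  (∫⁻ θ in Set.Ioc 0 (2 * Real.pi), toENN ((M : EReal) - u (cpt c r θ))) /
    ENNReal.ofReal (2 * Real.pi)

/-- Sub-mean value inequality for `u` at the circle of center `c` and radius `r`:
`u c ≤ (circle mean of u)`, expressed as `u c + (M - mean) ≤ M` for every
upper bound `M` of `u` on the circle. -/
def SubmeanAt (u : ℂ → EReal) (c : ℂ) (r : ℝ) : Prop :=
  ∀ M : ℝ, (∀ θ : ℝ, u (cpt c r θ) ≤ (M : EReal)) →
    u c + ((circleDeficit u c r M : ℝ≥0∞) : EReal) ≤ (M : EReal)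

/-- A function `u : ℂ → EReal` is subharmonic on a set `S` if it is upper semicontinuous on `S`
and satisfies the sub-mean value inequality on every closed disc contained in `S`. -/
def SubharmonicOn (u : ℂ → EReal) (S : Set ℂ) : Prop :=
  UpperSemicontinuousOn u S ∧
    ∀ c r, 0 < r → Metric.closedBall c r ⊆ S → SubmeanAt u c r

/-- A function with values in `[-∞, +∞)` is plurisubharmonic on `D` if it is upper
semicontinuous on `D` and its restriction to every complex line is subharmonic. -/
def PlurisubharmonicOn {E : Type*} [NormedAddCommGroup E] [NormedSpace ℂ E]
    (φ : E → EReal) (D : Set E) : Prop :=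
  UpperSemicontinuousOn φ D ∧
    ∀ a b : E, SubharmonicOn (fun w : ℂ => φ (a + w • b)) {w : ℂ | a + w • b ∈ D}

/-- A set is a pseudoconvex domain if it is open, connected and admits a continuous
plurisubharmonic exhaustion function. -/
def IsPseudoconvexDomain {E : Type*} [NormedAddCommGroup E] [NormedSpace ℂ E]
    (Ω : Set E) : Prop :=
  IsOpen Ω ∧ IsConnected Ω ∧
    ∃ ρ : E → ℝ, ContinuousOn ρ Ω ∧ PlurisubharmonicOn (fun z => (ρ z : EReal)) Ω ∧
      ∀ c : ℝ, IsCompact {z ∈ Ω | ρ z ≤ c}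

/-! We model a holomorphic vector bundle of finite rank `k` over a domain `D ⊆ ℂⁿ` in a fixed
holomorphic trivialization: the fiber over `z` is `ℂᵏ`, a singular Finsler metric is a function
`h : D → ℂᵏ → [0,+∞]` giving the *squared* norm `|v|_h² = h z v` on each fiber, holomorphic
sections of the dual bundle are holomorphic maps into `(ℂᵏ)*`, and holomorphic sections of the
`m`-th tensor power `E^{⊗m}` are holomorphic maps into the space of `m`-multilinear functionals
on `(ℂᵏ)*`. -/

variable {n k : ℕ}

/-- The squared-norm homogeneity condition of a singular Finsler metric. -/
def IsFinslerMetric (h : (Fin n → ℂ) → (Fin k → ℂ) → ℝ≥0∞) : Prop :=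
  ∀ z, ∀ c : ℂ, ∀ v : Fin k → ℂ, h z (c • v) = ((‖c‖₊ : ℝ≥0∞)) ^ 2 * h z v

/-- The dual Finsler metric on the dual bundle: `|f|_{h*} = sup { |f v| : |v|_h ≤ 1 }`, set to
`0` if `|v|_h = +∞` for every nonzero `v` in the fiber. -/
def dualFinsler (h : (Fin n → ℂ) → (Fin k → ℂ) → ℝ≥0∞) (z : Fin n → ℂ)
    (f : (Fin k → ℂ) →L[ℂ] ℂ) : ℝ≥0∞ :=
  if ∀ v : Fin k → ℂ, v ≠ 0 → h z v = ⊤ then 0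
  else ⨆ v ∈ {v : Fin k → ℂ | h z v ≤ 1}, (‖f v‖₊ : ℝ≥0∞)

/-- The induced Finsler metric on the `m`-th tensor power `E^{⊗m}`, viewing a vector of
`E_z^{⊗m}` as a multilinear functional `ξ` on `(E_z^*)^m`:
`|ξ| = sup { |ξ(u₁,…,u_m)| : |u_i|_{h*} ≤ 1 }`. -/
def tensorFinsler (h : (Fin n → ℂ) → (Fin k → ℂ) → ℝ≥0∞) (m : ℕ) (z : Fin n → ℂ)
    (ξ : ContinuousMultilinearMap ℂ (fun _ : Fin m => (Fin k → ℂ) →L[ℂ] ℂ) ℂ) : ℝ≥0∞ :=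
  ⨆ u ∈ {u : Fin m → (Fin k → ℂ) →L[ℂ] ℂ | ∀ i, dualFinsler h z (u i) ≤ 1},
    (‖ξ u‖₊ : ℝ≥0∞)

/-- The `m`-th tensor power `a^{⊗m}` of a vector `a ∈ ℂᵏ`, as the multilinear functional
`(u₁,…,u_m) ↦ ∏ᵢ uᵢ(a)` on the dual space. -/
def tensorPow (m : ℕ) (a : Fin k → ℂ) :
    ContinuousMultilinearMap ℂ (fun _ : Fin m => (Fin k → ℂ) →L[ℂ] ℂ) ℂ :=
  (ContinuousMultilinearMap.mkPiAlgebra ℂ (Fin m) ℂ).compContinuousLinearMap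
    (fun _ => ContinuousLinearMap.apply ℂ ℂ a)

/-- Multiple `L^p`-extension property of `(E,h)`: there are constants `C_m > 0` with
`(log C_m)/m → 0` such that for every `z ∈ D`, every nonzero `a ∈ E_z` of finite norm and every
`m ≥ 1` there is a holomorphic section `f` of `E^{⊗m}` on `D` with `f z = a^{⊗m}` and
`∫_D |f|^p ≤ C_m · |a|_h^{mp}`. -/
def MultipleLpExtension (D : Set (Fin n → ℂ)) (h : (Fin n → ℂ) → (Fin k → ℂ) → ℝ≥0∞)
    (p : ℝ) : Prop :=
  ∃ C : ℕ → ℝ, (∀ m, 0 < C m) ∧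
    Filter.Tendsto (fun m : ℕ => Real.log (C m) / (m : ℝ)) Filter.atTop (nhds 0) ∧
    ∀ z ∈ D, ∀ a : Fin k → ℂ, a ≠ 0 → h z a ≠ ⊤ → ∀ m : ℕ, 1 ≤ m →
      ∃ f : (Fin n → ℂ) → ContinuousMultilinearMap ℂ (fun _ : Fin m => (Fin k → ℂ) →L[ℂ] ℂ) ℂ,
        DifferentiableOn ℂ f D ∧ f z = tensorPow m a ∧
        (∫⁻ w in D, (tensorFinsler h m w (f w)) ^ p) ≤
          ENNReal.ofReal (C m) * (h z a) ^ ((m : ℝ) * p / 2)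

lemma jensen_le {g : ℂ → ℂ} (hg : AnalyticOnNhd ℂ g (Metric.closedBall 0 1)) (h0 : g 0 ≠ 0) :
    Real.log ‖g 0‖ ≤ Real.circleAverage (fun z => Real.log ‖g z‖) 0 1 := by
  have hg' : AnalyticOnNhd ℂ g (Metric.closedBall 0 |1|) := by simpa using hg
  rw [AnalyticOnNhd.circleAverage_log_norm one_ne_zero hg' h0]
  have : 0 ≤ ∑ᶠ u, (MeromorphicOn.divisor g (Metric.closedBall 0 |1|) u : ℝ) *
      Real.log (1 * ‖(0:ℂ) - u‖⁻¹) := by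
    apply finsum_nonneg
    intro u
    by_cases hu : u ∈ Metric.closedBall (0:ℂ) |1|
    · have h1 : 0 ≤ MeromorphicOn.divisor g (Metric.closedBall 0 |1|) u :=
        MeromorphicOn.AnalyticOnNhd.divisor_nonneg hg' u
      have hu' : ‖u‖ ≤ 1 := by simpa using hu
      apply mul_nonneg (by exact_mod_cast h1)
      simp only [zero_sub, norm_neg, one_mul, Real.log_inv]
      have := Real.log_nonpos (norm_nonneg u) hu'
      linarith
    · simp [Function.locallyFinsuppWithin.apply_eq_zero_of_notMem _ hu]
  linarith

lemma submean_1d {g : ℂ → ℂ} (hg : AnalyticOnNhd ℂ g (Metric.closedBall 0 1)) {p : ℝ}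
    (hp : 0 < p) :
    ‖g 0‖ ^ p ≤ Real.exp 1 * Real.circleAverage (fun z => ‖g z‖ ^ p) 0 1 := by
  have hcont : ContinuousOn (fun z => ‖g z‖ ^ p) (Metric.sphere 0 1) := by
    apply ContinuousOn.rpow_const
    · exact (hg.continuousOn.mono Metric.sphere_subset_closedBall).norm
    · intros; right; exact hp.le
  have hci : CircleIntegrable (fun z => ‖g z‖ ^ p) 0 1 := hcont.circleIntegrable zero_le_one
  by_cases h0 : g 0 = 0
  · simp only [h0, norm_zero, Real.zero_rpow hp.ne']
    apply mul_nonneg (Real.exp_pos _).le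
    apply Real.circleAverage_nonneg_of_nonneg
    intro x _
    positivity
  set s := ‖g 0‖ with hs
  have hspos : 0 < s := norm_pos_iff.2 h0
  set lam : ℝ := Real.exp (1 / p) / s with hlam
  have hlpos : 0 < lam := by positivity
  have hG : AnalyticOnNhd ℂ (fun z => (lam : ℂ) * g z) (Metric.closedBall 0 1) :=
    fun z hz => analyticAt_const.mul (hg z hz)
  have h1 := jensen_le hG (by simp [h0, hlpos.ne'])
  have e1 : ‖(lam : ℂ) * g 0‖ = Real.exp (1/p) := by
    rw [norm_mul, ← hs, Complex.norm_real, Real.norm_of_nonneg hlpos.le, hlam]; field_simp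
  have h2 : Real.circleAverage (fun z => Real.log ‖(lam : ℂ) * g z‖) 0 1 ≤
      Real.circleAverage (fun z => (lam ^ p / p) • ‖g z‖ ^ p) 0 1 := by
    apply Real.circleAverage_mono
    · apply MeromorphicOn.circleIntegrable_log_norm
      intro z hz
      exact (hG z (Metric.sphere_subset_closedBall (by simpa using hz))).meromorphicAt
    · exact hci.const_smul
    · intro z _
      have := Real.log_le_rpow_div (norm_nonneg ((lam : ℂ) * g z)) hp
      refine this.trans (le_of_eq ?_)
      rw [norm_mul, Real.mul_rpow (norm_nonneg _) (norm_nonneg _)]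
      simp [abs_of_pos hlpos]; ring
  rw [Real.circleAverage_fun_smul] at h2
  rw [e1, Real.log_exp] at h1
  have h3 := h1.trans h2
  have e2 : lam ^ p = Real.exp 1 / s ^ p := by
    rw [hlam, Real.div_rpow (Real.exp_pos _).le hspos.le, ← Real.exp_mul]
    congr 2; field_simp
  rw [e2, smul_eq_mul] at h3
  have hsp : 0 < s ^ p := Real.rpow_pos_of_pos hspos p
  set A := Real.circleAverage (fun z => ‖g z‖ ^ p) 0 1
  have : 1 / p = (1 / (p * s^p)) * s ^ p := by field_simp
  rw [this] at h3
  have h4 : Real.exp 1 / s ^ p / p * A = (1 / (p * s^p)) * (Real.exp 1 * A) := by field_simp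
  rw [h4] at h3
  exact le_of_mul_le_mul_left h3 (by positivity)

lemma submean_1d_lintegral {g : ℂ → ℂ} (hg : AnalyticOnNhd ℂ g (Metric.closedBall 0 1)) {p : ℝ}
    (hp : 0 < p) :
    ENNReal.ofReal (2 * Real.pi) * ‖g 0‖ₑ ^ p ≤ ENNReal.ofReal (Real.exp 1) *
      ∫⁻ θ in Set.Ioc 0 (2 * Real.pi), ‖g (Complex.exp (θ * Complex.I))‖ₑ ^ p := by
  have h := submean_1d hg hp
  have hcont : ContinuousOn (fun z => ‖g z‖ ^ p) (Metric.sphere 0 1) := by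
    apply ContinuousOn.rpow_const
    · exact (hg.continuousOn.mono Metric.sphere_subset_closedBall).norm
    · intros; right; exact hp.le
  have hci : CircleIntegrable (fun z => ‖g z‖ ^ p) 0 1 := hcont.circleIntegrable zero_le_one
  have hpi := Real.two_pi_pos
  rw [Real.circleAverage_def, intervalIntegral.integral_of_le hpi.le] at h
  have hI : Integrable (fun θ : ℝ => ‖g (circleMap 0 1 θ)‖ ^ p)
      (volume.restrict (Ioc 0 (2 * Real.pi))) := by
    have := hci
    rw [CircleIntegrable, intervalIntegrable_iff_integrableOn_Ioc_of_le hpi.le] at this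
    exact this
  have h2 := ofReal_integral_eq_lintegral_ofReal hI (Filter.Eventually.of_forall fun _ => by positivity)
  have e : ∀ z : ℂ, ENNReal.ofReal (‖z‖ ^ p) = ‖z‖ₑ ^ p := by
    intro z
    rw [← ENNReal.ofReal_rpow_of_nonneg (norm_nonneg _) hp.le, ofReal_norm]
  simp only [e] at h2
  have e3 : ∀ θ : ℝ, circleMap 0 1 θ = Complex.exp (θ * Complex.I) := by intro θ; simp [circleMap]
  simp only [e3] at h2 h
  rw [← h2, ← e, ← ENNReal.ofReal_mul hpi.le, ← ENNReal.ofReal_mul (Real.exp_pos _).le]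
  apply ENNReal.ofReal_le_ofReal
  calc _ ≤ 2 * Real.pi * _ := mul_le_mul_of_nonneg_left h hpi.le
    _ = _ := by
      rw [smul_eq_mul]
      generalize (∫ (x : ℝ) in Ioc 0 (2 * Real.pi), ‖g (cexp (↑x * I))‖ ^ p) = J
      field_simp

lemma mp_rot (n : ℕ) (θ : ℝ) : MeasurePreserving
    (fun v : Fin n → ℂ => Complex.exp (θ * Complex.I) • v) volume volume := by
  have h1 : MeasurePreserving (fun z : ℂ => Complex.exp (θ * Complex.I) * z) volume volume := by
    have := (rotation (Circle.exp θ)).measurePreserving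
    have e : (fun z : ℂ => Complex.exp (θ * Complex.I) * z) = rotation (Circle.exp θ) := by
      ext z; simp [rotation_apply, Circle.coe_exp]
    rw [e]; exact this
  have := volume_preserving_pi (fun _ : Fin n => h1)
  exact this

lemma submean_nd {n : ℕ} {F : (Fin n → ℂ) → ℂ} {ζ : Fin n → ℂ} {δ : ℝ}
    (hF : DifferentiableOn ℂ F (Metric.ball ζ δ)) {p : ℝ} (hp : 0 < p) :
    volume (Metric.ball (0 : Fin n → ℂ) δ) * ‖F ζ‖ₑ ^ p ≤
      ENNReal.ofReal (Real.exp 1) * ∫⁻ z in Metric.ball ζ δ, ‖F z‖ₑ ^ p := by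
  set B := Metric.ball (0 : Fin n → ℂ) δ with hB
  have hBm : MeasurableSet B := Metric.isOpen_ball.measurableSet
  set W : (Fin n → ℂ) → ℝ≥0∞ := B.indicator (fun v => ‖F (ζ + v)‖ₑ ^ p) with hW
  have hWm : Measurable W := by
    have hc : ContinuousOn (fun v => ‖F (ζ + v)‖ₑ ^ p) B := by
      apply (ENNReal.continuous_rpow_const (y := p)).comp_continuousOn
      apply continuous_enorm.comp_continuousOn
      apply hF.continuousOn.comp (by fun_prop)
      intro v hv
      simpa [hB] using hv
    have := hc.measurable_piecewise (g := fun _ => 0) continuousOn_const hBm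
    rw [hW, ← Set.piecewise_eq_indicator]
    convert this
    rfl
  have e1 : ∫⁻ z in Metric.ball ζ δ, ‖F z‖ₑ ^ p = ∫⁻ v, W v := by
    rw [hW, lintegral_indicator hBm, ← lintegral_indicator Metric.isOpen_ball.measurableSet,
      ← lintegral_indicator hBm, ← lintegral_add_left_eq_self _ ζ]
    congr 1; ext v
    simp only [Set.indicator_apply, hB]
    congr 1
    simp
  have key : ∀ v ∈ B, ENNReal.ofReal (2 * Real.pi) * ‖F ζ‖ₑ ^ p ≤ ENNReal.ofReal (Real.exp 1) *
      ∫⁻ θ in Set.Ioc 0 (2 * Real.pi), W (Complex.exp ((θ : ℝ) * Complex.I) • v) := by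
    intro v hv
    have hv' : ‖v‖ < δ := by simpa [hB] using hv
    have hopen : IsOpen {w : ℂ | ‖w • v‖ < δ} := by
      apply isOpen_lt <;> fun_prop
    have hd : DifferentiableOn ℂ (fun w : ℂ => F (ζ + w • v)) {w : ℂ | ‖w • v‖ < δ} := by
      apply hF.comp (by fun_prop)
      intro w hw
      simpa using hw
    have ha : AnalyticOnNhd ℂ (fun w : ℂ => F (ζ + w • v)) (Metric.closedBall 0 1) := by
      apply (hd.analyticOnNhd hopen).mono
      intro w hw
      have hw' : ‖w‖ ≤ 1 := by simpa using hw
      simp only [mem_ofPred_eq, norm_smul]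
      nlinarith [norm_nonneg v]
    have := submean_1d_lintegral ha hp
    simp only [zero_smul, add_zero] at this
    refine this.trans (le_of_eq ?_)
    congr 2; ext θ
    rw [hW, Set.indicator_of_mem]
    simpa [hB, norm_smul, Complex.norm_exp_ofReal_mul_I] using hv'
  have hmeas2 : Measurable (fun q : (Fin n → ℂ) × ℝ => W (Complex.exp ((q.2 : ℝ) * Complex.I) • q.1)) := by
    apply hWm.comp
    apply Continuous.measurable
    fun_prop
  have h1 : (ENNReal.ofReal (2 * Real.pi) * ‖F ζ‖ₑ ^ p) * volume B ≤
      ∫⁻ v in B, ENNReal.ofReal (Real.exp 1) *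
      ∫⁻ θ in Set.Ioc 0 (2 * Real.pi), W (Complex.exp ((θ : ℝ) * Complex.I) • v) := by
    rw [← setLIntegral_const]
    exact setLIntegral_mono' hBm key
  have h2 : ∫⁻ v in B, ENNReal.ofReal (Real.exp 1) *
      ∫⁻ θ in Set.Ioc 0 (2 * Real.pi), W (Complex.exp ((θ : ℝ) * Complex.I) • v) ≤
      ENNReal.ofReal (Real.exp 1) * (ENNReal.ofReal (2 * Real.pi) * ∫⁻ v, W v) := by
    rw [lintegral_const_mul' _ _ ENNReal.ofReal_ne_top]
    gcongr
    calc _ ≤ ∫⁻ v, ∫⁻ θ in Set.Ioc 0 (2 * Real.pi), W (Complex.exp ((θ : ℝ) * Complex.I) • v) :=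
          setLIntegral_le_lintegral _ _
      _ = ∫⁻ θ in Set.Ioc 0 (2 * Real.pi), ∫⁻ v, W (Complex.exp ((θ : ℝ) * Complex.I) • v) :=
          lintegral_lintegral_swap hmeas2.aemeasurable
      _ = ∫⁻ θ in Set.Ioc 0 (2 * Real.pi), ∫⁻ v, W v := by
          congr 1; ext θ
          exact (mp_rot n θ).lintegral_comp hWm
      _ = _ := by
          rw [setLIntegral_const, mul_comm]; simp
  have h3 := h1.trans h2
  rw [e1]
  have hpos : ENNReal.ofReal (2 * Real.pi) ≠ 0 := by simp [Real.pi_pos]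
  rw [mul_assoc, mul_left_comm (ENNReal.ofReal (Real.exp 1)),
    ENNReal.mul_le_mul_iff_right hpos ENNReal.ofReal_ne_top] at h3
  rw [mul_comm (volume B)]
  exact h3

lemma trig_approx {c : ℂ} {r : ℝ} (hr : 0 < r) {g : ℂ → ℝ} (hg : Continuous g) {ε : ℝ}
    (hε : 0 < ε) : ∃ P : ℂ → ℂ, Differentiable ℂ P ∧
      ∀ θ : ℝ, |(P (cpt c r θ)).re - g (cpt c r θ)| < ε := by
  have : Fact (0 < 2 * Real.pi) := ⟨Real.two_pi_pos⟩
  let G : C(AddCircle (2 * Real.pi), ℂ) :=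
    ⟨fun t => (g (c + r * (AddCircle.toCircle t : ℂ)) : ℂ), by fun_prop⟩
  have hmem : G ∈ (Submodule.span ℂ (range (@fourier (2 * Real.pi)))).topologicalClosure := by
    rw [span_fourier_closure_eq_top]; trivial
  have hmem' : G ∈ closure ((Submodule.span ℂ (range (@fourier (2 * Real.pi))) :
      Set C(AddCircle (2 * Real.pi), ℂ))) := hmem
  obtain ⟨H, hH, hd⟩ := Metric.mem_closure_iff.1 hmem' ε hε
  have key : ∀ H ∈ Submodule.span ℂ (range (@fourier (2 * Real.pi))),
      ∃ P Q : ℂ → ℂ, Differentiable ℂ P ∧ Differentiable ℂ Q ∧ ∀ t : AddCircle (2 * Real.pi),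
        H t = P (AddCircle.toCircle t) + (starRingEnd ℂ) (Q (AddCircle.toCircle t)) := by
    intro H hH
    induction hH using Submodule.span_induction with
    | mem x hx =>
      obtain ⟨m, rfl⟩ := hx
      rcases Int.eq_nat_or_neg m with ⟨k, rfl | rfl⟩
      · refine ⟨fun z => z ^ k, fun _ => 0, by fun_prop, by fun_prop, fun t => ?_⟩
        rw [fourier_apply, AddCircle.toCircle_zsmul]; simp
      · refine ⟨fun _ => 0, fun z => z ^ k, by fun_prop, by fun_prop, fun t => ?_⟩
        rw [fourier_neg, fourier_apply, AddCircle.toCircle_zsmul]; simp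
    | zero => exact ⟨fun _ => 0, fun _ => 0, by fun_prop, by fun_prop, fun t => by simp⟩
    | add x y _ _ hx hy =>
      obtain ⟨P, Q, hP, hQ, h⟩ := hx
      obtain ⟨P', Q', hP', hQ', h'⟩ := hy
      refine ⟨fun z => P z + P' z, fun z => Q z + Q' z, hP.add hP', hQ.add hQ', fun t => ?_⟩
      simp only [ContinuousMap.add_apply, h, h', map_add]; ring
    | smul a x _ hx =>
      obtain ⟨P, Q, hP, hQ, h⟩ := hx
      refine ⟨fun z => a * P z, fun z => (starRingEnd ℂ) a * Q z, hP.const_mul a,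
        hQ.const_mul _, fun t => ?_⟩
      simp only [ContinuousMap.smul_apply, smul_eq_mul, h, map_mul, Complex.conj_conj]; ring
  obtain ⟨P, Q, hP, hQ, hPQ⟩ := key H hH
  refine ⟨fun z => P ((z - c) / r) + Q ((z - c) / r), ?_, fun θ => ?_⟩
  · exact (hP.comp (by fun_prop)).add (hQ.comp (by fun_prop))
  · have hrc : (r : ℂ) ≠ 0 := by exact_mod_cast hr.ne'
    have e1 : (cpt c r θ - c) / r = Complex.exp (θ * Complex.I) := by
      simp [cpt]; field_simp
    have e2 : ((AddCircle.toCircle (θ : AddCircle (2 * Real.pi)) : Circle) : ℂ)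
        = Complex.exp (θ * Complex.I) := by
      rw [AddCircle.toCircle_apply_mk, Circle.coe_exp]
      congr 2
      have := Real.pi_ne_zero
      push_cast
      field_simp
    have h1 : dist (G (θ : AddCircle (2 * Real.pi))) (H (θ : AddCircle (2 * Real.pi))) < ε :=
      (ContinuousMap.dist_apply_le_dist _).trans_lt hd
    rw [hPQ, e2, Complex.dist_eq] at h1
    have e3 : G (θ : AddCircle (2 * Real.pi)) = (g (cpt c r θ) : ℂ) := by
      change (g (c + r * ((AddCircle.toCircle (θ : AddCircle (2 * Real.pi)) : Circle) : ℂ)) : ℂ) = _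
      rw [e2]; rfl
    rw [e3] at h1
    have h2 := (Complex.abs_re_le_norm _).trans_lt h1
    have e4 : ∀ (X Y : ℂ) (s : ℝ),
        |(X + Y).re - s| = |((s : ℂ) - (X + (starRingEnd ℂ) Y)).re| := by
      intro X Y s
      rw [← abs_neg]
      congr 1
      simp only [Complex.add_re, Complex.sub_re, Complex.conj_re, Complex.ofReal_re]
      ring
    beta_reduce
    rw [e1, e4]
    exact h2

lemma coe_lt_toENN (M : ℝ) (y : EReal) (t : ℝ≥0) :
    (t : ℝ≥0∞) < toENN ((M : EReal) - y) ↔ y < ((M - t : ℝ) : EReal) := by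
  induction y with
  | bot => simp [toENN, EReal.bot_lt_coe, -EReal.coe_sub]
  | top => simp [toENN]
  | coe y =>
    have : (M : EReal) - (y : EReal) = ((M - y : ℝ) : EReal) := by simp
    rw [this, toENN, if_neg (EReal.coe_ne_top _), EReal.toReal_coe, EReal.coe_lt_coe_iff]
    have e : (t : ℝ≥0∞) = ENNReal.ofReal (t : ℝ) := by simp
    rw [e, ENNReal.ofReal_lt_ofReal_iff_of_nonneg t.coe_nonneg]
    constructor <;> intro h <;> linarith

lemma le_of_le_toENN {M : ℝ} {y : EReal} {t : ℝ} (ht : 0 ≤ t) (hy : y ≤ (M : EReal))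
    (h : ENNReal.ofReal t ≤ toENN ((M : EReal) - y)) : y ≤ ((M - t : ℝ) : EReal) := by
  induction y with
  | bot => exact bot_le
  | top => simp at hy
  | coe y =>
    have : (M : EReal) - (y : EReal) = ((M - y : ℝ) : EReal) := by simp
    rw [this, toENN, if_neg (EReal.coe_ne_top _), EReal.toReal_coe] at h
    rw [EReal.coe_le_coe_iff] at hy ⊢
    rw [ENNReal.ofReal_le_ofReal_iff (by linarith)] at h
    linarith

/-- Lipschitz minorants of an extended nonnegative function on `S`. -/
def lipMin (f : ℂ → ℝ≥0∞) (S : Set ℂ) (j : ℕ) (x : ℂ) : ℝ≥0∞ :=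
  min (j : ℝ≥0∞) (⨅ y ∈ S, f y + j * edist x y)

lemma lipMin_ne_top (f : ℂ → ℝ≥0∞) (S : Set ℂ) (j : ℕ) (x : ℂ) : lipMin f S j x ≠ ⊤ :=
  ne_top_of_le_ne_top (ENNReal.natCast_ne_top j) (min_le_left _ _)

lemma lipMin_le (f : ℂ → ℝ≥0∞) (S : Set ℂ) (j : ℕ) {x : ℂ} (hx : x ∈ S) :
    lipMin f S j x ≤ f x := by
  refine (min_le_right _ _).trans ((iInf₂_le x hx).trans ?_)
  simp

lemma lipMin_mono (f : ℂ → ℝ≥0∞) (S : Set ℂ) (x : ℂ) : Monotone (fun j => lipMin f S j x) := by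
  intro i j hij
  have : (i : ℝ≥0∞) ≤ j := by exact_mod_cast hij
  simp only [lipMin]
  gcongr

lemma lipMin_continuous (f : ℂ → ℝ≥0∞) (S : Set ℂ) (j : ℕ) :
    Continuous (fun x => (lipMin f S j x).toReal) := by
  refine (LipschitzWith.of_le_add_mul (j : ℝ≥0) fun x y => ?_).continuous
  have h : lipMin f S j x ≤ lipMin f S j y + j * edist x y := by
    simp only [lipMin]
    rw [min_add]
    apply le_min
    · exact (min_le_left _ _).trans le_self_add
    · refine (min_le_right _ _).trans ?_
      rw [ENNReal.iInf₂_add]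
      apply le_iInf₂ fun w hw => ?_
      refine (iInf₂_le w hw).trans ?_
      rw [add_assoc, ← mul_add]
      gcongr
      rw [add_comm]
      exact edist_triangle _ _ _
  have h2 := ENNReal.toReal_mono (by
    simp [lipMin_ne_top, edist_ne_top, ENNReal.mul_eq_top]) h
  rw [ENNReal.toReal_add (lipMin_ne_top _ _ _ _) (by
    simp [edist_ne_top, ENNReal.mul_eq_top])] at h2
  simpa [ENNReal.toReal_mul, edist_dist] using h2

lemma iSup_lipMin (f : ℂ → ℝ≥0∞) (S : Set ℂ) {x : ℂ} (hx : x ∈ S)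
    (hf : LowerSemicontinuousWithinAt f S x) : ⨆ j, lipMin f S j x = f x := by
  apply le_antisymm (iSup_le fun j => lipMin_le f S j hx)
  apply le_of_forall_lt
  intro t ht
  obtain ⟨t', htt', ht'⟩ := exists_between ht
  have hev := hf t' ht'
  obtain ⟨ρ, hρ, hball⟩ := EMetric.mem_nhdsWithin_iff.1 hev
  have htt : t' ≠ ⊤ := ne_top_of_lt ht'
  obtain ⟨ρ', hρ'0, hρ'⟩ := exists_between hρ
  have hρ't : ρ' ≠ ⊤ := ne_top_of_lt hρ'
  obtain ⟨j1, hj1⟩ := ENNReal.exists_nat_gt htt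
  obtain ⟨j2, hj2⟩ := ENNReal.exists_nat_mul_gt hρ'0.ne' htt
  refine htt'.trans_le (le_trans ?_ (le_iSup _ (max j1 j2)))
  have hm1 : (j1 : ℝ≥0∞) ≤ (max j1 j2 : ℕ) := by exact_mod_cast le_max_left _ _
  have hm2 : (j2 : ℝ≥0∞) ≤ (max j1 j2 : ℕ) := by exact_mod_cast le_max_right _ _
  apply le_min (hj1.le.trans hm1)
  apply le_iInf₂ fun y hy => ?_
  by_cases hd : edist y x < ρ
  · have : t' < f y := hball ⟨hd, hy⟩
    exact this.le.trans le_self_add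
  · push Not at hd
    calc t' ≤ j2 * ρ' := hj2.le
      _ ≤ (max j1 j2 : ℕ) * edist x y := by
        gcongr
        rw [edist_comm]; exact hρ'.le.trans hd
      _ ≤ _ := le_add_self

lemma cpt_eq_circleMap (c : ℂ) (r θ : ℝ) : cpt c r θ = circleMap c r θ := rfl

lemma cpt_mem (c : ℂ) {r : ℝ} (hr : 0 < r) (θ : ℝ) : cpt c r θ ∈ Metric.sphere c r := by
  rw [cpt_eq_circleMap]; exact circleMap_mem_sphere c hr.le θ

lemma mean_re {P : ℂ → ℂ} (hP : Differentiable ℂ P) (c : ℂ) (r : ℝ) :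
    Real.circleAverage (fun z => (P z).re) c r = (P c).re := by
  have h := InnerProductSpace.HarmonicOnNhd.circleAverage_eq (f := fun z => (P z).re) (c := c)
    (R := r) (fun x _ => (hP.analyticAt x).harmonicAt_re)
  exact h

lemma submean_of_claim (u : ℂ → EReal) (c : ℂ) (r : ℝ) (hr : 0 < r)
    (husc : UpperSemicontinuousOn u (Metric.sphere c r))
    (claim : ∀ P : ℂ → ℂ, Differentiable ℂ P →
      (∀ θ : ℝ, u (cpt c r θ) < ((P (cpt c r θ)).re : EReal)) → u c ≤ ((P c).re : EReal)) :
    SubmeanAt u c r := by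
  intro M hM
  set S := Metric.sphere c r with hS
  set f : ℂ → ℝ≥0∞ := fun y => toENN ((M : EReal) - u y) with hf
  have hlsc : ∀ x ∈ S, LowerSemicontinuousWithinAt f S x := by
    intro x hx t ht
    have htt : t ≠ ⊤ := ne_top_of_lt ht
    lift t to ℝ≥0 using htt
    have h1 := (coe_lt_toENN M (u x) t).1 ht
    filter_upwards [husc x hx _ h1] with y hy
    exact (coe_lt_toENN M (u y) t).2 hy
  -- key inequality
  have key : ∀ j : ℕ, u c ≤
      ((M - Real.circleAverage (fun x => (lipMin f S j x).toReal) c r : ℝ) : EReal) := by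
    intro j
    set g : ℂ → ℝ := fun x => (lipMin f S j x).toReal with hg
    have hgc : Continuous g := lipMin_continuous f S j
    have hgi : CircleIntegrable g c r := hgc.continuousOn.circleIntegrable'
    rw [← EReal.le_of_forall_lt_iff_le]
    intro z hz
    rw [EReal.coe_lt_coe_iff] at hz
    set ε := (z - (M - Real.circleAverage g c r)) / 2 with hε
    have hεpos : 0 < ε := by rw [hε]; linarith
    obtain ⟨P, hP, hPa⟩ := trig_approx (c := c) hr (g := fun x => M - g x + ε)
      (by fun_prop) hεpos
    have hle := claim P hP fun θ => by
      have h1 : u (cpt c r θ) ≤ ((M - g (cpt c r θ) : ℝ) : EReal) := by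
        apply le_of_le_toENN ENNReal.toReal_nonneg (hM θ)
        rw [ENNReal.ofReal_toReal (lipMin_ne_top _ _ _ _)]
        exact lipMin_le f S j (cpt_mem c hr θ)
      refine h1.trans_lt ?_
      rw [EReal.coe_lt_coe_iff]
      have := (abs_lt.1 (hPa θ)).1
      linarith
    refine hle.trans ?_
    rw [EReal.coe_le_coe_iff, ← mean_re hP c r]
    have hz2 : z = Real.circleAverage (fun x => (M + 2 * ε) - g x) c r := by
      rw [Real.circleAverage_fun_sub (circleIntegrable_const _ _ _) hgi, Real.circleAverage_const]
      rw [hε]; ring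
    rw [hz2]
    apply Real.circleAverage_mono
    · have := hP.continuous
      exact (Complex.continuous_re.comp this).continuousOn.circleIntegrable'
    · exact (continuous_const.sub hgc).continuousOn.circleIntegrable'
    · intro x hx
      rw [abs_of_pos hr] at hx
      obtain ⟨θ, rfl⟩ : ∃ θ, circleMap c r θ = x := by
        have : x ∈ range (circleMap c r) := by
          rw [range_circleMap, abs_of_pos hr]; exact hx
        exact this
      have := (abs_lt.1 (hPa θ)).2
      rw [cpt_eq_circleMap] at this
      linarith
  rcases eq_or_ne (u c) ⊥ with hb | hb
  · simp [hb]
  have hnt : u c ≠ ⊤ := ne_top_of_le_ne_top (EReal.coe_ne_top _) (key 0)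
  lift u c to ℝ using ⟨hnt, hb⟩ with x hx
  have hcpt : Continuous (cpt c r) := by unfold cpt; fun_prop
  have hpi := Real.two_pi_pos
  have hdef : circleDeficit u c r M ≤ ENNReal.ofReal (M - x) := by
    rw [circleDeficit]
    apply ENNReal.div_le_of_le_mul
    have e1 : ∀ θ, toENN ((M : EReal) - u (cpt c r θ)) = ⨆ j, lipMin f S j (cpt c r θ) :=
      fun θ => (iSup_lipMin f S (cpt_mem c hr θ) (hlsc _ (cpt_mem c hr θ))).symm
    simp only [e1]
    have e2 : ∀ j θ, lipMin f S j (cpt c r θ) = ENNReal.ofReal (lipMin f S j (cpt c r θ)).toReal :=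
      fun j θ => (ENNReal.ofReal_toReal (lipMin_ne_top _ _ _ _)).symm
    rw [lintegral_iSup]
    · apply iSup_le fun j => ?_
      have hc : Continuous fun θ => (lipMin f S j (cpt c r θ)).toReal :=
        (lipMin_continuous f S j).comp hcpt
      rw [lintegral_congr (e2 j)]
      rw [← ofReal_integral_eq_lintegral_ofReal, ← ENNReal.ofReal_mul' hpi.le]
      · apply ENNReal.ofReal_le_ofReal
        have hk := EReal.coe_le_coe_iff.1 (key j)
        rw [Real.circleAverage_def, intervalIntegral.integral_of_le hpi.le, smul_eq_mul] at hk
        simp only [← cpt_eq_circleMap] at hk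
        have : (2 * Real.pi)⁻¹ * (∫ θ in Ioc 0 (2 * Real.pi), (lipMin f S j (cpt c r θ)).toReal)
          ≤ M - x := by linarith
        rw [inv_mul_le_iff₀ hpi] at this
        rw [mul_comm (M - x)]; exact this
      · exact hc.continuousOn.integrableOn_Icc.mono_set Ioc_subset_Icc_self
      · exact Filter.Eventually.of_forall fun _ => ENNReal.toReal_nonneg
    · intro j
      have hc : Continuous fun θ => (lipMin f S j (cpt c r θ)).toReal :=
        (lipMin_continuous f S j).comp hcpt
      rw [funext (e2 j)]
      exact hc.measurable.ennreal_ofReal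
    · intro i j hij θ
      exact lipMin_mono f S _ hij
  have hx0 : x ≤ M := by
    have hk := EReal.coe_le_coe_iff.1 (key 0)
    have : 0 ≤ Real.circleAverage (fun x => (lipMin f S 0 x).toReal) c r :=
      Real.circleAverage_nonneg_of_nonneg fun _ _ => ENNReal.toReal_nonneg
    linarith
  calc (x : EReal) + ((circleDeficit u c r M : ℝ≥0∞) : EReal)
      ≤ (x : EReal) + ((ENNReal.ofReal (M - x) : ℝ≥0∞) : EReal) := by
        gcongr
        exact_mod_cast hdef
    _ = M := by
        rw [EReal.coe_ennreal_ofReal, max_eq_left (by linarith), ← EReal.coe_add]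
        congr 1; ring

lemma dual_smul (h : (Fin n → ℂ) → (Fin k → ℂ) → ℝ≥0∞) (z : Fin n → ℂ)
    (f : (Fin k → ℂ) →L[ℂ] ℂ) (s : ℂ) :
    dualFinsler h z (s • f) = ‖s‖ₑ * dualFinsler h z f := by
  unfold dualFinsler
  split_ifs with hc
  · simp
  · simp only [ENNReal.mul_iSup]
    congr 1; ext v; congr 1; ext hv
    simp [← enorm_eq_nnnorm, enorm_mul]

lemma disc_bound {D : Set (Fin n → ℂ)} {h : (Fin n → ℂ) → (Fin k → ℂ) → ℝ≥0∞}
    {p : ℝ} (hp : 0 < p) (hext : MultipleLpExtension D h p)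
    {V : Set (Fin n → ℂ)} (hV : IsOpen V) (hVD : V ⊆ D)
    {u : (Fin n → ℂ) → (Fin k → ℂ) →L[ℂ] ℂ} (hu : DifferentiableOn ℂ u V)
    (husc : UpperSemicontinuousOn (fun z => dualFinsler h z (u z)) V)
    (a b : Fin n → ℂ) (c : ℂ) (r : ℝ) (hr : 0 < r)
    (hdisc : ∀ w ∈ Metric.closedBall c r, a + w • b ∈ V)
    (hcirc : ∀ w ∈ Metric.sphere c r, dualFinsler h (a + w • b) (u (a + w • b)) < 1) :
    dualFinsler h (a + c • b) (u (a + c • b)) ≤ 1 := by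
  by_contra hcon
  push Not at hcon
  set z0 := a + c • b with hz0
  have hz0V : z0 ∈ V := hdisc c (by simp [hr.le])
  -- the vector
  obtain ⟨v, hv1, hv2⟩ : ∃ v, h z0 v ≤ 1 ∧ 1 < ‖u z0 v‖ₑ := by
    unfold dualFinsler at hcon
    split_ifs at hcon with hc
    · simp at hcon
    · rw [lt_iSup_iff] at hcon
      obtain ⟨v, hv⟩ := hcon
      rw [lt_iSup_iff] at hv
      obtain ⟨hv1, hv2⟩ := hv
      exact ⟨v, hv1, hv2⟩
  have hv0 : v ≠ 0 := by
    rintro rfl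
    simp at hv2
  have hvt : h z0 v ≠ ⊤ := ne_top_of_le_ne_top ENNReal.one_ne_top hv1
  set q := ‖u z0 v‖ with hq
  have hq1 : 1 < q := by
    rw [← ofReal_norm, ← ENNReal.ofReal_one] at hv2
    exact (ENNReal.ofReal_lt_ofReal_iff_of_nonneg zero_le_one).1 hv2
  -- thickened circle
  set A : Set (Fin n → ℂ) := {z ∈ V | dualFinsler h z (u z) < 1} with hA
  have hAo : IsOpen A := by
    rw [isOpen_iff_mem_nhds]
    rintro x ⟨hxV, hx⟩
    have h1 := husc x hxV 1 hx
    rw [hV.nhdsWithin_eq hxV] at h1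
    filter_upwards [h1, hV.mem_nhds hxV] with y hy hyV
    exact ⟨hyV, hy⟩
  set K : Set (Fin n → ℂ) := Set.image (fun w : ℂ => a + w • b) (Metric.sphere c r) with hK
  have hKc : IsCompact K := (isCompact_sphere c r).image (by fun_prop)
  have hKA : K ⊆ A := by
    rintro _ ⟨w, hw, rfl⟩
    exact ⟨hdisc w (Metric.sphere_subset_closedBall hw), hcirc w hw⟩
  obtain ⟨δ, hδ, hδA⟩ := hKc.exists_thickening_subset_open hAo hKA
  set κ := volume (Metric.ball (0 : Fin n → ℂ) δ) with hκ
  have hκ0 : κ ≠ 0 := (Metric.measure_ball_pos volume _ hδ).ne'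
  have hκt : κ ≠ ⊤ := measure_ball_lt_top.ne
  obtain ⟨C, hC0, hClim, hC⟩ := hext
  have main : ∀ m : ℕ, 1 ≤ m → κ.toReal * (q ^ m) ^ p ≤ Real.exp 1 * C m := by
    intro m hm
    obtain ⟨f, hfd, hfz, hfi⟩ := hC z0 (hVD hz0V) v hv0 hvt m hm
    set F : (Fin n → ℂ) → ℂ := fun z => f z (fun _ => u z) with hF
    have hFd : DifferentiableOn ℂ F V := by
      intro z hz
      have h1 : DifferentiableWithinAt ℂ f V z := (hfd.mono hVD) z hz
      exact (h1.hasFDerivWithinAt.continuousMultilinearMap_apply (g := fun _ z => u z)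
        (fun _ => (hu z hz).hasFDerivWithinAt)).differentiableWithinAt
    have hintF : ∫⁻ z in A, ‖F z‖ₑ ^ p ≤ ENNReal.ofReal (C m) := by
      calc ∫⁻ z in A, ‖F z‖ₑ ^ p ≤ ∫⁻ z in A, (tensorFinsler h m z (f z)) ^ p := by
            apply setLIntegral_mono' hAo.measurableSet
            intro z hz
            gcongr
            unfold tensorFinsler
            exact le_iSup₂_of_le (fun _ => u z) (fun _ => hz.2.le) le_rfl
        _ ≤ ∫⁻ z in D, (tensorFinsler h m z (f z)) ^ p :=
            lintegral_mono_set fun z hz => hVD hz.1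
        _ ≤ _ := hfi
        _ ≤ ENNReal.ofReal (C m) * 1 := by
            gcongr
            apply ENNReal.rpow_le_one hv1
            positivity
        _ = _ := mul_one _
    have hcb : ∀ w ∈ Metric.sphere c r, ‖F (a + w • b)‖ ≤
        (Real.exp 1 * C m / κ.toReal) ^ (1 / p) := by
      intro w hw
      have hball : Metric.ball (a + w • b) δ ⊆ A := by
        refine Subset.trans ?_ hδA
        exact Metric.ball_subset_thickening (show a + w • b ∈ K from ⟨w, hw, rfl⟩) δ
      have h1 := submean_nd (F := F) (ζ := a + w • b) (δ := δ)
        (hFd.mono fun z hz => (hball hz).1) hp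
      have h2 : κ * ‖F (a + w • b)‖ₑ ^ p ≤ ENNReal.ofReal (Real.exp 1 * C m) := by
        refine h1.trans ?_
        rw [ENNReal.ofReal_mul (Real.exp_pos 1).le]
        gcongr
        exact (lintegral_mono_set hball).trans hintF
      have h3 := ENNReal.toReal_mono ENNReal.ofReal_ne_top h2
      rw [ENNReal.toReal_mul, ← ENNReal.toReal_rpow, toReal_enorm,
        ENNReal.toReal_ofReal (mul_pos (Real.exp_pos 1) (hC0 m)).le] at h3
      have hκp := ENNReal.toReal_pos hκ0 hκt
      rw [one_div, Real.le_rpow_inv_iff_of_pos (norm_nonneg _) (by have := hC0 m; positivity) hp,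
        le_div_iff₀ hκp]
      linarith
    have hmax : ‖F z0‖ ≤ (Real.exp 1 * C m / κ.toReal) ^ (1 / p) := by
      have hd : DifferentiableOn ℂ (fun w : ℂ => F (a + w • b)) (Metric.closedBall c r) :=
        hFd.comp (by fun_prop) hdisc
      have hd' : DiffContOnCl ℂ (fun w : ℂ => F (a + w • b)) (Metric.ball c r) :=
        ⟨hd.mono Metric.ball_subset_closedBall,
          by rw [closure_ball c hr.ne']; exact hd.continuousOn⟩
      refine Complex.norm_le_of_forall_mem_frontier_norm_le (f := fun w : ℂ => F (a + w • b))
        Metric.isBounded_ball hd' ?_ (z := c) (subset_closure (by simp [hr]))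
      intro w hw
      rw [frontier_ball c hr.ne'] at hw
      exact hcb w hw
    have hFz : ‖F z0‖ = q ^ m := by
      simp only [hF, hfz, tensorPow]
      simp [hq]
    rw [hFz] at hmax
    have hκp := ENNReal.toReal_pos hκ0 hκt
    have hqm : 0 ≤ q ^ m := by positivity
    have h5 := Real.rpow_le_rpow hqm hmax hp.le
    rw [← Real.rpow_mul (by have := hC0 m; positivity), one_div_mul_cancel hp.ne', Real.rpow_one,
      le_div_iff₀ hκp] at h5
    linarith
  have hκp := ENNReal.toReal_pos hκ0 hκt
  have hlog : ∀ m : ℕ, 1 ≤ m → p * Real.log q ≤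
      (1 - Real.log κ.toReal) / m + Real.log (C m) / m := by
    intro m hm
    have h1 := main m hm
    have hmp : (0:ℝ) < m := by exact_mod_cast hm
    have hq0 : 0 < q := by linarith
    have h2 := Real.log_le_log (by positivity) h1
    rw [Real.log_mul hκp.ne' (by positivity), Real.log_rpow (by positivity), Real.log_pow,
      Real.log_mul (Real.exp_pos 1).ne' (hC0 m).ne', Real.log_exp] at h2
    rw [← add_div, le_div_iff₀ hmp]
    linarith
  have hlim : Filter.Tendsto (fun m : ℕ => (1 - Real.log κ.toReal) / m + Real.log (C m) / m)
      Filter.atTop (nhds (0 + 0)) :=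
    (tendsto_const_div_atTop_nhds_zero_nat _).add hClim
  have hfin := ge_of_tendsto hlim (Filter.eventually_atTop.2 ⟨1, hlog⟩)
  have := mul_pos hp (Real.log_pos hq1)
  linarith

lemma logE_enorm_exp (w : ℂ) (x : ℝ≥0∞) :
    logE x < ((w.re : ℝ) : EReal) ↔ ‖Complex.exp (-w)‖ₑ * x < 1 := by
  have hpos : 0 < Real.exp (-w.re) := Real.exp_pos _
  have e : ‖Complex.exp (-w)‖ₑ = ENNReal.ofReal (Real.exp (-w.re)) := by
    rw [← ofReal_norm, Complex.norm_exp]; simp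
  have e2 : ((w.re : ℝ) : EReal) = ENNReal.log (ENNReal.ofReal (Real.exp w.re)) := by
    rw [ENNReal.log_ofReal_of_pos (Real.exp_pos _), Real.log_exp]
  rw [e, e2, logE, ENNReal.log_lt_log_iff, Real.exp_neg, ENNReal.ofReal_inv_of_pos (Real.exp_pos _)]
  set y := ENNReal.ofReal (Real.exp w.re)
  have hy0 : y ≠ 0 := by simp [y, Real.exp_pos]
  have hyt : y ≠ ⊤ := ENNReal.ofReal_ne_top
  rw [mul_comm, ← div_eq_mul_inv, ENNReal.div_lt_iff (Or.inl hy0) (Or.inl hyt), one_mul]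

lemma logE_enorm_exp_le (w : ℂ) (x : ℝ≥0∞) :
    logE x ≤ ((w.re : ℝ) : EReal) ↔ ‖Complex.exp (-w)‖ₑ * x ≤ 1 := by
  have hpos : 0 < Real.exp (-w.re) := Real.exp_pos _
  have e : ‖Complex.exp (-w)‖ₑ = ENNReal.ofReal (Real.exp (-w.re)) := by
    rw [← ofReal_norm, Complex.norm_exp]; simp
  have e2 : ((w.re : ℝ) : EReal) = ENNReal.log (ENNReal.ofReal (Real.exp w.re)) := by
    rw [ENNReal.log_ofReal_of_pos (Real.exp_pos _), Real.log_exp]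
  rw [e, e2, logE, ENNReal.log_le_log_iff, Real.exp_neg, ENNReal.ofReal_inv_of_pos (Real.exp_pos _)]
  set y := ENNReal.ofReal (Real.exp w.re)
  have hy0 : y ≠ 0 := by simp [y, Real.exp_pos]
  have hyt : y ≠ ⊤ := ENNReal.ofReal_ne_top
  rw [mul_comm, ← div_eq_mul_inv, ENNReal.div_le_iff hy0 hyt, one_mul]

lemma const_claim (x : EReal) (P : ℂ → ℂ) (hP : Differentiable ℂ P) (c : ℂ) (r : ℝ) (hr : 0 < r)
    (hx : ∀ θ : ℝ, x < ((P (cpt c r θ)).re : EReal)) : x ≤ ((P c).re : EReal) := by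
  induction x with
  | bot => exact bot_le
  | top => exact absurd (hx 0) not_top_lt
  | coe x =>
    rw [EReal.coe_le_coe_iff, ← mean_re hP c r, ← Real.circleAverage_const x c r]
    apply Real.circleAverage_mono
    · exact circleIntegrable_const _ _ _
    · have := hP.continuous
      exact (Complex.continuous_re.comp this).continuousOn.circleIntegrable'
    · intro y hy
      obtain ⟨θ, rfl⟩ : ∃ θ, circleMap c r θ = y := by
        have : y ∈ range (circleMap c r) := by
          rw [range_circleMap]; exact hy
        exact this
      exact (EReal.coe_lt_coe_iff.1 (hx θ)).le

/-- Let `(E,h)` be a holomorphic vector bundle of finite rank over a bounded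
domain `D ⊆ ℂⁿ` with a singular Finsler metric such that the norm of every local holomorphic
section of `E*` is upper semicontinuous. If `(E,h)` has the multiple `L^p`-extension property
for some `p > 0`, then `(E,h)` is positively curved in the sense of Griffiths: `log |u|_{h*}`
is plurisubharmonic for every local holomorphic section `u` of `E*`. -/
theorem statement3 (D : Set (Fin n → ℂ)) (hDopen : IsOpen D) (hDconn : IsConnected D)
    (hDbdd : Bornology.IsBounded D)
    (h : (Fin n → ℂ) → (Fin k → ℂ) → ℝ≥0∞) (hFinsler : IsFinslerMetric h)
    (husc : ∀ V : Set (Fin n → ℂ), IsOpen V → V ⊆ D →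
      ∀ u : (Fin n → ℂ) → (Fin k → ℂ) →L[ℂ] ℂ, DifferentiableOn ℂ u V →
        UpperSemicontinuousOn (fun z => dualFinsler h z (u z)) V)
    (p : ℝ) (hp : 0 < p) (hext : MultipleLpExtension D h p) :
    ∀ V : Set (Fin n → ℂ), IsOpen V → V ⊆ D →
      ∀ u : (Fin n → ℂ) → (Fin k → ℂ) →L[ℂ] ℂ, DifferentiableOn ℂ u V →
        PlurisubharmonicOn (fun z => logE (dualFinsler h z (u z))) V := by
  intro V hV hVD u hu
  have husc1 : UpperSemicontinuousOn (fun z => logE (dualFinsler h z (u z))) V :=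
    ENNReal.continuous_log.comp_upperSemicontinuousOn (husc V hV hVD u hu) ENNReal.log_monotone
  refine ⟨husc1, fun a b => ?_⟩
  have husc2 : UpperSemicontinuousOn
      (fun w : ℂ => logE (dualFinsler h (a + w • b) (u (a + w • b)))) {w : ℂ | a + w • b ∈ V} :=
    UpperSemicontinuousOn.comp (g := fun w : ℂ => a + w • b) husc1 (by fun_prop) (fun w hw => hw)
  refine ⟨husc2, fun c r hr hball => ?_⟩
  apply submean_of_claim _ c r hr (husc2.mono (Metric.sphere_subset_closedBall.trans hball))
  intro P hP hlt
  by_cases hb : b = 0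
  · subst hb
    simp only [smul_zero, add_zero] at hlt ⊢
    exact const_claim _ P hP c r hr hlt
  obtain ⟨i, hi⟩ : ∃ i, b i ≠ 0 := by
    by_contra hcon
    push Not at hcon
    exact hb (funext hcon)
  set u' : (Fin n → ℂ) → (Fin k → ℂ) →L[ℂ] ℂ :=
    fun z => Complex.exp (-P ((z i - a i) / b i)) • u z with hu'
  have hu'd : DifferentiableOn ℂ u' V := by
    have hs : Differentiable ℂ (fun z : Fin n → ℂ => Complex.exp (-P ((z i - a i) / b i))) := by
      apply Differentiable.cexp
      apply Differentiable.neg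
      exact hP.comp (g := P) (f := fun z : Fin n → ℂ => (z i - a i) / b i) (by fun_prop)
    exact hs.differentiableOn.smul hu
  have hval : ∀ w : ℂ, dualFinsler h (a + w • b) (u' (a + w • b)) =
      ‖Complex.exp (-P w)‖ₑ * dualFinsler h (a + w • b) (u (a + w • b)) := by
    intro w
    have e : ((a + w • b) i - a i) / b i = w := by simp [hi]
    simp only [hu', e, dual_smul]
  have := disc_bound hp hext hV hVD hu'd (husc V hV hVD u' hu'd) a b c r hr hball ?_
  · rw [hval] at this
    exact (logE_enorm_exp_le _ _).2 this
  · intro w hw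
    obtain ⟨θ, rfl⟩ : ∃ θ, circleMap c r θ = w := by
      have : w ∈ range (circleMap c r) := by
        rw [range_circleMap, abs_of_pos hr]; exact hw
      exact this
    rw [hval]
    exact (logE_enorm_exp _ _).1 (hlt θ)
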